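/- Let μ be a σ-finite measure on a measurable space Ω and let p, q, r : Ω → ℝ≥0 be measurable with ∫ p dμ = ∫ q dμ = ∫ r dμ = 1, and set m = (q+r)/2. Then ∫ (p·log(p/(p+m)) + m·log(m/(p+m))) dμ ≥ −log 4, where the integrand is interpreted as 0 on {p+m = 0}, and equality holds if and only if p = m μ-almost everywhere. -/

import Mathlib

open MeasureTheory

/-- The negated generator integrand is a rescaled binary entropy. -/
theorem neg_mul_log_div_add_eq_mul_binEntropy {a b : ℝ} (h : a + b ≠ 0) :
    -(a * Real.log (a / (a + b)) + b * Real.log (b / (a + b))) =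
      (a + b) * Real.binEntropy (a / (a + b)) := by
  have h1 : 1 - a / (a + b) = b / (a + b) := by field_simp; ring
  rw [Real.binEntropy, h1, Real.log_inv, Real.log_inv]
  field_simp
  ring

theorem neg_mul_log_div_add_le {a b : ℝ} (ha : 0 ≤ a) (hb : 0 ≤ b) :
    -(a * Real.log (a / (a + b)) + b * Real.log (b / (a + b))) ≤ (a + b) * Real.log 2 := by
  rcases eq_or_ne (a + b) 0 with h | h
  · obtain ⟨rfl, rfl⟩ := (add_eq_zero_iff_of_nonneg ha hb).1 h
    simp
  · rw [neg_mul_log_div_add_eq_mul_binEntropy h]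
    exact mul_le_mul_of_nonneg_left Real.binEntropy_le_log_two (add_nonneg ha hb)

theorem neg_mul_log_div_add_nonneg {a b : ℝ} (ha : 0 ≤ a) (hb : 0 ≤ b) :
    0 ≤ -(a * Real.log (a / (a + b)) + b * Real.log (b / (a + b))) := by
  rcases eq_or_ne (a + b) 0 with h | h
  · simp [h]
  · rw [neg_mul_log_div_add_eq_mul_binEntropy h]
    exact mul_nonneg (add_nonneg ha hb) (Real.binEntropy_nonneg (by positivity)
      (div_le_one_of_le₀ (by linarith) (by positivity)))

theorem neg_mul_log_div_add_eq_iff {a b : ℝ} (ha : 0 ≤ a) (hb : 0 ≤ b) :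
    -(a * Real.log (a / (a + b)) + b * Real.log (b / (a + b))) = (a + b) * Real.log 2 ↔
      a = b := by
  rcases eq_or_ne (a + b) 0 with h | h
  · obtain ⟨rfl, rfl⟩ := (add_eq_zero_iff_of_nonneg ha hb).1 h
    simp
  · rw [neg_mul_log_div_add_eq_mul_binEntropy h, mul_right_inj' h,
      Real.binEntropy_eq_log_two, div_eq_iff h]
    constructor <;> intro h <;> linarith

/-- Lemma 2, first part. Let `μ` be σ-finite and `p, q, r : Ω → ℝ≥0` measurable with
`∫ p dμ = ∫ q dμ = ∫ r dμ = 1`, and set `m = (q+r)/2`. Then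
`∫ (p·log (p/(p+m)) + m·log (m/(p+m))) dμ ≥ −log 4`,
where the integral is the `[-∞,0]`-valued (`EReal`-valued) integral of a nonpositive
integrand (which vanishes on `{p + m = 0}` since there `p = 0` and `m = 0`),
and equality holds if and only if `p = m` `μ`-almost everywhere. -/
theorem generator_objective_ge_neg_log_four {Ω : Type*} [MeasurableSpace Ω]
    (μ : Measure Ω) [SigmaFinite μ]
    (p q r : Ω → NNReal) (hp : Measurable p) (hq : Measurable q) (hr : Measurable r)
    (hp1 : ∫⁻ ω, (p ω : ENNReal) ∂μ = 1) (hq1 : ∫⁻ ω, (q ω : ENNReal) ∂μ = 1)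
    (hr1 : ∫⁻ ω, (r ω : ENNReal) ∂μ = 1)
    (m : Ω → NNReal) (hm : m = fun ω => (q ω + r ω) / 2) :
    ((-Real.log 4 : ℝ) : EReal) ≤
      -((∫⁻ ω, ENNReal.ofReal
          (-((p ω : ℝ) * Real.log ((p ω : ℝ) / ((p ω : ℝ) + (m ω : ℝ)))
            + (m ω : ℝ) * Real.log ((m ω : ℝ) / ((p ω : ℝ) + (m ω : ℝ))))) ∂μ : ENNReal) : EReal) ∧
    (-((∫⁻ ω, ENNReal.ofReal
          (-((p ω : ℝ) * Real.log ((p ω : ℝ) / ((p ω : ℝ) + (m ω : ℝ)))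
            + (m ω : ℝ) * Real.log ((m ω : ℝ) / ((p ω : ℝ) + (m ω : ℝ))))) ∂μ : ENNReal) : EReal)
        = ((-Real.log 4 : ℝ) : EReal) ↔ ∀ᵐ ω ∂μ, p ω = m ω) := by
  have hmm : Measurable m := by rw [hm]; fun_prop
  have hm1 : ∫⁻ ω, (m ω : ENNReal) ∂μ = 1 := by
    have h (ω : Ω) : (m ω : ENNReal) = ((q ω : ENNReal) + r ω) * 2⁻¹ := by
      simp [hm, div_eq_mul_inv]
    simp_rw [h]
    rw [lintegral_mul_const _ (by fun_prop), lintegral_add_left (by fun_prop), hq1, hr1,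
      one_add_one_eq_two, ENNReal.mul_inv_cancel (by simp) (by simp)]
  set f : Ω → ℝ := fun ω => -((p ω : ℝ) * Real.log ((p ω : ℝ) / ((p ω : ℝ) + (m ω : ℝ)))
    + (m ω : ℝ) * Real.log ((m ω : ℝ) / ((p ω : ℝ) + (m ω : ℝ))))
  set g : Ω → ℝ := fun ω => ((p ω : ℝ) + m ω) * Real.log 2 with hg
  have hfg (ω : Ω) : f ω ≤ g ω := neg_mul_log_div_add_le (p ω).2 (m ω).2
  have hf0 (ω : Ω) : 0 ≤ f ω := neg_mul_log_div_add_nonneg (p ω).2 (m ω).2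
  have hg0 (ω : Ω) : 0 ≤ g ω := (hf0 ω).trans (hfg ω)
  have hfm : Measurable f := by fun_prop
  have hgm : Measurable g := by fun_prop
  have hgint : ∫⁻ ω, ENNReal.ofReal (g ω) ∂μ = ENNReal.ofReal (Real.log 4) := by
    have h (ω : Ω) : ENNReal.ofReal (g ω) =
        ((p ω : ENNReal) + m ω) * ENNReal.ofReal (Real.log 2) := by
      rw [hg, ENNReal.ofReal_mul (by positivity), ENNReal.ofReal_add (p ω).coe_nonneg (m ω).coe_nonneg,
        ENNReal.ofReal_coe_nnreal, ENNReal.ofReal_coe_nnreal]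
    simp_rw [h]
    rw [lintegral_mul_const _ (by fun_prop), lintegral_add_left (by fun_prop), hp1, hm1,
      one_add_one_eq_two, show (4 : ℝ) = 2 ^ 2 by norm_num, Real.log_pow,
      ENNReal.ofReal_mul (by positivity)]
    simp
  have hcoe : ((-Real.log 4 : ℝ) : EReal) =
      -((∫⁻ ω, ENNReal.ofReal (g ω) ∂μ : ENNReal) : EReal) := by
    rw [hgint, EReal.coe_ennreal_ofReal, max_eq_left (Real.log_nonneg (by norm_num)),
      EReal.coe_neg]
  have hle (ω : Ω) : ENNReal.ofReal (f ω) ≤ ENNReal.ofReal (g ω) :=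
    ENNReal.ofReal_le_ofReal (hfg ω)
  rw [hcoe]
  refine ⟨EReal.neg_le_neg_iff.2 (EReal.coe_ennreal_le_coe_ennreal_iff.2 (lintegral_mono hle)), ?_⟩
  have hpt (ω : Ω) : ENNReal.ofReal (f ω) = ENNReal.ofReal (g ω) ↔ p ω = m ω := by
    rw [ENNReal.ofReal_eq_ofReal_iff (hf0 ω) (hg0 ω), ← NNReal.coe_inj]
    exact neg_mul_log_div_add_eq_iff (p ω).2 (m ω).2
  rw [neg_inj, EReal.coe_ennreal_eq_coe_ennreal_iff]
  constructor
  · intro h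
    have hae := ae_eq_of_ae_le_of_lintegral_le (ae_of_all μ hle)
      (by rw [h, hgint]; exact ENNReal.ofReal_ne_top) hgm.ennreal_ofReal.aemeasurable h.ge
    filter_upwards [hae] with ω hω using (hpt ω).1 hω
  · intro h
    refine lintegral_congr_ae ?_
    filter_upwards [h] with ω hω using (hpt ω).2 hω
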